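/- For every natural number n, M_{2,n} = fib(n+2)², where fib is the Fibonacci sequence with fib(0)=0, fib(1)=fib(2)=1. -/

import Mathlib

/-- There exist indices `i, j` with `A (i+1, j) = A (i, j+1) = 1` (anti-diagonal pair). -/
def hasAnti (m n : ℕ) (A : Fin m × Fin n → Bool) : Prop :=
  ∃ i j, ∃ (hi : i + 1 < m) (hj : j + 1 < n),
    A (⟨i + 1, hi⟩, ⟨j, by omega⟩) = true ∧ A (⟨i, by omega⟩, ⟨j + 1, hj⟩) = true

/-- There exist indices `i, j` with `A (i, j) = A (i+1, j+1) = 1` (main-diagonal pair). -/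
def hasMain (m n : ℕ) (A : Fin m × Fin n → Bool) : Prop :=
  ∃ i j, ∃ (hi : i + 1 < m) (hj : j + 1 < n),
    A (⟨i, by omega⟩, ⟨j, by omega⟩) = true ∧ A (⟨i + 1, hi⟩, ⟨j + 1, hj⟩) = true

/-- `M m n`: the number of `m × n` binary matrices with no two 1's diagonally adjacent,
i.e. the number of placements of mutually nonattacking pawns on an `m × n` board. -/
noncomputable def M (m n : ℕ) : ℕ :=
  Nat.card {A : Fin m × Fin n → Bool // ¬ hasAnti m n A ∧ ¬ hasMain m n A}

/-- Binary words of length `n` with no two consecutive `true`s. -/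
abbrev SparseWord (n : ℕ) : Type :=
  {f : Fin n → Bool // ∀ j (hj : j + 1 < n),
    ¬ (f ⟨j, by omega⟩ = true ∧ f ⟨j + 1, hj⟩ = true)}

/-- A sparse word of length `n + 2` starts with `false`, followed by a sparse word of length
`n + 1`, or with `true, false`, followed by a sparse word of length `n`. -/
def sparseWordSuccSucc (n : ℕ) :
    SparseWord (n + 1) ⊕ SparseWord n ≃ SparseWord (n + 2) where
  toFun
    | .inl f => ⟨Fin.cons false f.1, by
        rintro (_ | j) hj ⟨h₁, h₂⟩
        · exact Bool.false_ne_true h₁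
        · exact f.2 j (by omega) ⟨h₁, h₂⟩⟩
    | .inr f => ⟨Fin.cons true (Fin.cons false f.1 : Fin (n + 1) → Bool), by
        rintro (_ | _ | j) hj ⟨h₁, h₂⟩
        · exact Bool.false_ne_true h₂
        · exact Bool.false_ne_true h₁
        · exact f.2 j (by omega) ⟨h₁, h₂⟩⟩
  invFun f :=
    if f.1 0 then
      .inr ⟨fun j => f.1 j.succ.succ, fun j hj h => f.2 (j + 2) (by omega) h⟩
    else
      .inl ⟨fun j => f.1 j.succ, fun j hj h => f.2 (j + 1) (by omega) h⟩
  left_inv := by rintro (f | f) <;> simp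
  right_inv f := by
    by_cases h : f.1 0 = true
    · have h₁ : f.1 1 = false := by
        have := f.2 0 (by omega)
        exact Bool.eq_false_iff.2 fun h' => this ⟨h, h'⟩
      simp only [h, if_true]
      ext j
      refine Fin.cases h.symm (fun j => Fin.cases h₁.symm (fun j => rfl) j) j
    · simp only [h]
      ext j
      exact Fin.cases (Bool.eq_false_iff.2 h).symm (fun j => rfl) j

theorem card_sparseWord (n : ℕ) : Nat.card (SparseWord n) = Nat.fib (n + 2) := by
  induction n using Nat.twoStepInduction with
  | zero => simp [SparseWord, Nat.card_eq_fintype_card]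
  | one =>
    rw [Nat.card_congr (Equiv.subtypeUnivEquiv fun f j hj => by omega)]
    simp [Nat.fib_add_two]
  | more n h₀ h₁ =>
    rw [← Nat.card_congr (sparseWordSuccSucc n), Nat.card_sum, h₀, h₁, Nat.fib_add_two (n := n + 2),
      add_comm]

theorem not_hasAnti_and_not_hasMain_two_iff {n : ℕ} (A : Fin 2 × Fin n → Bool) :
    ¬ hasAnti 2 n A ∧ ¬ hasMain 2 n A ↔ ∀ (a : Fin 2) (j) (hj : j + 1 < n),
      ¬ (A (a, ⟨j, by omega⟩) = true ∧ A (a + 1, ⟨j + 1, hj⟩) = true) := by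
  constructor
  · rintro ⟨hA, hM⟩ a j hj h
    fin_cases a
    · exact hM ⟨0, j, by omega, hj, h⟩
    · exact hA ⟨0, j, by omega, hj, h⟩
  · intro h
    constructor
    · rintro ⟨i, j, hi, hj, h'⟩
      obtain rfl : i = 0 := by omega
      exact h 1 j hj h'
    · rintro ⟨i, j, hi, hj, h'⟩
      obtain rfl : i = 0 := by omega
      exact h 0 j hj h'

/-- Reading a `2 × n` matrix along its two zigzags identifies placements of nonattacking pawns
with pairs of sparse words. -/
def pawnPlacementEquiv (n : ℕ) :
    {A : Fin 2 × Fin n → Bool // ¬ hasAnti 2 n A ∧ ¬ hasMain 2 n A} ≃ (Fin 2 → SparseWord n) where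
  toFun A i := ⟨fun j => A.1 (i + Fin.ofNat 2 j, j), fun j hj h => by
    refine (not_hasAnti_and_not_hasMain_two_iff A.1).1 A.2 (i + Fin.ofNat 2 j) j hj ⟨h.1, ?_⟩
    have e : i + Fin.ofNat 2 j + 1 = i + Fin.ofNat 2 (j + 1) := by
      ext; simp [Fin.val_add]; omega
    rw [e]
    exact h.2⟩
  invFun s := ⟨fun p => (s (p.1 - Fin.ofNat 2 p.2)).1 p.2, by
    refine (not_hasAnti_and_not_hasMain_two_iff _).2 fun a j hj h => ?_
    have e : a + 1 - Fin.ofNat 2 (j + 1) = a - Fin.ofNat 2 j := by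
      ext; simp [Fin.val_add, Fin.val_sub]; omega
    simp only [e] at h
    exact (s (a - Fin.ofNat 2 j)).2 j hj h⟩
  left_inv A := by ext p; simp
  right_inv s := by ext i j; simp

theorem M_two_eq_fib_sq (n : ℕ) : M 2 n = Nat.fib (n + 2) ^ 2 := by
  rw [M, Nat.card_congr (pawnPlacementEquiv n), Nat.card_fun, card_sparseWord, Nat.card_fin]
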